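/- If L is piecewise-testable and F is a finite language, then the shuffle L ⧢ F is piecewise-testable. -/

import Mathlib

open List

variable {A : Type*}

/-- Extract the subword of `x` at positions `K`. -/
def extractW (x : List A) (K : Finset (Fin x.length)) : List A :=
  ((List.finRange x.length).filter (fun i => i ∈ K)).map x.get

/-- `InterpW C u v x` : `x` is a shuffle of `u` and `v` with possible sharing of letters in `C`. -/
def InterpW (C : Set A) (u v x : List A) : Prop :=
  ∃ K K' : Finset (Fin x.length), K ∪ K' = Finset.univ ∧
    extractW x K = u ∧ extractW x K' = v ∧ ∀ a ∈ extractW x (K ∩ K'), a ∈ C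

/-- Interpolation product of languages. -/
def interpL (C : Set A) (L L' : Set (List A)) : Set (List A) :=
  {x | ∃ u ∈ L, ∃ v ∈ L', InterpW C u v x}

/-- Shuffle product of languages. -/
def shuffleL (L L' : Set (List A)) : Set (List A) := interpL ∅ L L'

/-- Simon's congruence: same scattered subwords of length at most `k`. -/
def SimK (k : ℕ) (u v : List A) : Prop :=
  ∀ w : List A, w.length ≤ k → (w.Sublist u ↔ w.Sublist v)

/-- Piecewise-testability: union of `∼ₖ`-classes for some `k`. -/
def PT (L : Set (List A)) : Prop :=
  ∃ k, ∀ u v : List A, SimK k u v → (u ∈ L ↔ v ∈ L)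

/-- A DFA is acyclic when every cycle is a self-loop. -/
def DFA.Acyclic {σ : Type*} (M : DFA A σ) : Prop :=
  ∀ p q (u v : List A), M.evalFrom p u = q → M.evalFrom q v = p → p = q

/-- A language is ℛ-trivial iff it is recognized by a finite acyclic DFA. -/
def RTrivial (L : Set (List A)) : Prop :=
  ∃ (σ : Type) (_ : Fintype σ) (M : DFA A σ), M.Acyclic ∧ ∀ x, x ∈ M.accepts ↔ x ∈ L

/-- The letters of a two-coloured word that are coloured `c`, in order. -/
def colorPart (c : Bool) (l : List (A × Bool)) : List A :=
  (l.filter (fun y => y.2 == c)).map Prod.fst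

theorem colorPart_append (c : Bool) (l l' : List (A × Bool)) :
    colorPart c (l ++ l') = colorPart c l ++ colorPart c l' := by
  simp [colorPart]

theorem colorPart_reverse (c : Bool) (l : List (A × Bool)) :
    colorPart c l.reverse = (colorPart c l).reverse := by
  simp [colorPart]

theorem colorPart_sublist (c : Bool) (l : List (A × Bool)) :
    (colorPart c l).Sublist (l.map Prod.fst) :=
  List.filter_sublist.map _

theorem colorPart_map_const (x : List A) (c d : Bool) :
    colorPart c (x.map fun a => (a, d)) = if d = c then x else [] := by
  induction x with
  | nil => simp [colorPart]
  | cons a x ih => cases c <;> cases d <;> simp_all [colorPart]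

theorem colorPart_true_of_false_eq_nil (l : List (A × Bool)) (h : colorPart false l = []) :
    colorPart true l = l.map Prod.fst := by
  induction l with
  | nil => rfl
  | cons a l ih => rcases a with ⟨a, _ | _⟩ <;> simp_all [colorPart]

theorem exists_coloring_of_sublist {w x : List A} (h : w.Sublist x) :
    ∃ l : List (A × Bool), l.map Prod.fst = x ∧ colorPart false l = w := by
  induction h with
  | slnil => exact ⟨[], rfl, rfl⟩
  | cons a _ ih =>
    obtain ⟨l, rfl, rfl⟩ := ih
    exact ⟨(a, true) :: l, by simp, by simp [colorPart]⟩
  | cons_cons a _ ih =>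
    obtain ⟨l, rfl, rfl⟩ := ih
    exact ⟨(a, false) :: l, by simp, by simp [colorPart]⟩

theorem mem_shuffleL_iff (L L' : Set (List A)) (x : List A) :
    x ∈ shuffleL L L' ↔ ∃ l : List (A × Bool),
      l.map Prod.fst = x ∧ colorPart true l ∈ L ∧ colorPart false l ∈ L' := by
  constructor
  · rintro ⟨u, hu, v, hv, K, K', hun, rfl, rfl, hdisj⟩
    have hemp : ∀ i, i ∈ K → i ∉ K' := by
      intro i hi hi'
      refine hdisj (x.get i) ?_
      simp only [extractW, List.mem_map, List.mem_filter]
      exact ⟨i, by simp [hi, hi'], rfl⟩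
    have hK' : ∀ i, i ∈ K' ↔ i ∉ K := by
      intro i
      have : i ∈ K ∪ K' := hun ▸ Finset.mem_univ i
      have h2 := hemp i
      rw [Finset.mem_union] at this
      tauto
    refine ⟨(List.finRange x.length).map fun i => (x.get i, decide (i ∈ K)), ?_, ?_, ?_⟩
    · simp [Function.comp_def]
    · convert hu using 1
      simp [colorPart, extractW, List.filter_map, Function.comp_def]
    · convert hv using 1
      simp [colorPart, extractW, List.filter_map, Function.comp_def, hK']
  · rintro ⟨l, rfl, hu, hv⟩
    have hlen : (l.map Prod.fst).length = l.length := by simp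
    have key : ∀ c : Bool, extractW (l.map Prod.fst)
        (Finset.univ.filter fun i => (l.get (i.cast hlen)).2 = c) = colorPart c l := by
      intro c
      have h1 : l = (List.finRange (l.map Prod.fst).length).map fun i => l.get (i.cast hlen) := by
        apply List.ext_get <;> simp
      conv_rhs => rw [h1]
      simp only [colorPart, extractW, List.filter_map, List.map_map, Function.comp_def]
      have h2 : (List.map Prod.fst l).get = fun i => (l.get (i.cast hlen)).1 := by
        ext i; simp
      rw [h2]
      congr 2
      ext i
      simp [Bool.beq_eq_decide_eq]
    refine ⟨_, hu, _, hv, _, _, ?_, key true, key false, ?_⟩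
    · ext i; simp
    · intro a ha
      simp only [extractW, List.mem_map, List.mem_filter] at ha
      obtain ⟨i, ⟨-, hi⟩, -⟩ := ha
      simp at hi

theorem SimK.symm {k : ℕ} {u v : List A} (h : SimK k u v) : SimK k v u :=
  fun w hw => (h w hw).symm

theorem SimK.trans {k : ℕ} {u v w : List A} (h : SimK k u v) (h' : SimK k v w) : SimK k u w :=
  fun x hx => (h x hx).trans (h' x hx)

theorem SimK.of_reverse {k : ℕ} {u v : List A} (h : SimK k u.reverse v.reverse) :
    SimK k u v := by
  intro w hw
  rw [← List.reverse_sublist, h w.reverse (by simpa using hw), List.reverse_sublist]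

/-- A word lying between `u` and a `∼ₖ`-equivalent superword is `∼ₖ`-equivalent to `u`. -/
theorem SimK.of_sublist_sublist {k : ℕ} {u v w : List A} (h : SimK k u w) (huv : u.Sublist v)
    (hvw : v.Sublist w) : SimK k u v :=
  fun x hx => ⟨fun hxu => hxu.trans huv, fun hxv => (h x hx).2 (hxv.trans hvw)⟩

theorem append_cons_sublist_cases {p q r s : List A} {b : A}
    (h : (r ++ b :: s).Sublist (p ++ q)) :
    (r ++ [b]).Sublist p ∨ (b :: s).Sublist q := by
  obtain ⟨l₁, l₂, h12, h1, h2⟩ := List.sublist_append_iff.1 h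
  rcases List.append_eq_append_iff.1 h12 with ⟨t, rfl, ht⟩ | ⟨t, rfl, ht⟩
  · cases t with
    | nil =>
      right
      rw [List.nil_append] at ht
      rwa [ht]
    | cons c t =>
      left
      simp only [List.cons_append, List.cons.injEq] at ht
      obtain ⟨rfl, rfl⟩ := ht
      exact (List.Sublist.append_left (by simp) r).trans h1
  · right
    rw [ht] at h2
    exact (List.sublist_append_right _ _).trans h2

/-- If inserting `b` between `u` and `a :: f` produces a new subword of length at most `n`,
and `u ++ a :: f` is `∼ₙ`-equivalent to `u ++ b :: g`, then there are `r`, `s` as stated. -/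
theorem exists_of_not_simK_insert {n : ℕ} {u f g : List A} {a b : A}
    (h : SimK n (u ++ a :: f) (u ++ b :: g)) (hb : ¬ SimK n (u ++ a :: f) (u ++ b :: a :: f)) :
    ∃ r s : List A, r.length + s.length + 1 ≤ n ∧ r.Sublist u ∧ s.Sublist (a :: f) ∧
      ¬ (r ++ [b]).Sublist u ∧ ¬ s.Sublist g := by
  have : ∃ w : List A, w.length ≤ n ∧ w.Sublist (u ++ b :: a :: f) ∧
      ¬ w.Sublist (u ++ a :: f) := by
    by_contra! hc
    exact hb fun w hw => ⟨fun hs => hs.trans (by simp), hc w hw⟩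
  obtain ⟨w, hw, hs, hns⟩ := this
  obtain ⟨r, s, rfl, hr, hs⟩ := List.sublist_append_iff.1 hs
  cases hs with
  | cons _ hs => exact absurd (hr.append hs) hns
  | @cons_cons s _ _ hs =>
    refine ⟨r, s, by simp at hw; omega, hr, hs, ?_, ?_⟩
    · intro h'
      exact hns (by simpa using h'.append hs)
    · intro h'
      exact hns ((h _ hw).2 (hr.append (h'.cons_cons b)))

theorem not_sublist_of_simK {n : ℕ} {u f g r s : List A} {a b : A} (hab : a ≠ b)
    (h : SimK n (u ++ a :: f) (u ++ b :: g)) (hr : r.Sublist u) (hra : ¬ (r ++ [a]).Sublist u)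
    (hs : s.Sublist (a :: f)) (hsg : ¬ s.Sublist g) : n < r.length + s.length + 1 := by
  by_contra! hn
  have key : ∀ t : List A, (r ++ a :: t).Sublist (u ++ b :: g) → (a :: t).Sublist g := by
    intro t ht
    rcases append_cons_sublist_cases ht with h1 | h1
    · exact absurd h1 hra
    · cases h1 with
      | cons _ h1 => exact h1
      | cons_cons _ h1 => exact absurd rfl hab
  cases hs with
  | cons _ hs =>
    have := key s ((h _ (by simp; omega)).1 (hr.append (hs.cons_cons a)))
    exact hsg ((List.sublist_cons_self a s).trans this)
  | @cons_cons s _ _ hs =>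
    exact hsg (key s ((h _ (by simp at hn ⊢; omega)).1 (hr.append (hs.cons_cons a))))

/-- One of the two words can be brought closer to the other by inserting a letter. -/
theorem simK_insert_or_insert {n : ℕ} {u f g : List A} {a b : A} (hab : a ≠ b)
    (h : SimK n (u ++ a :: f) (u ++ b :: g)) :
    SimK n (u ++ a :: f) (u ++ b :: a :: f) ∨ SimK n (u ++ b :: g) (u ++ a :: b :: g) := by
  by_contra! hc
  obtain ⟨r, s, hl, hr, hs, hrb, hsg⟩ := exists_of_not_simK_insert h hc.1
  obtain ⟨r', s', hl', hr', hs', hra, hsf⟩ := exists_of_not_simK_insert h.symm hc.2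
  have h1 := not_sublist_of_simK hab h hr' hra hs hsg
  have h2 := not_sublist_of_simK hab.symm h.symm hr hrb hs' hsf
  omega

/-- A language invariant under inserting letters within `∼ₙ`-classes is a union of classes. -/
theorem mem_iff_of_simK {n : ℕ} {S : Set (List A)}
    (hS : ∀ (p q : List A) (b : A), SimK n (p ++ q) (p ++ b :: q) →
      (p ++ q ∈ S ↔ p ++ b :: q ∈ S)) {x y : List A} (h : SimK n x y) : x ∈ S ↔ y ∈ S := by
  suffices H : ∀ (N : ℕ) (u f g : List A), f.length + g.length ≤ N → SimK n (u ++ f) (u ++ g) →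
      (u ++ f ∈ S ↔ u ++ g ∈ S) from H _ [] x y le_rfl h
  intro N
  induction N with
  | zero =>
    intro u f g hN _
    have hf : f = [] := List.length_eq_zero_iff.1 (by omega)
    have hg : g = [] := List.length_eq_zero_iff.1 (by omega)
    rw [hf, hg]
  | succ N ih =>
    have key : ∀ (u f g : List A) (b : A), f.length + g.length ≤ N →
        SimK n (u ++ f) (u ++ b :: g) → SimK n (u ++ f) (u ++ b :: f) →
        (u ++ f ∈ S ↔ u ++ b :: g ∈ S) := by
      intro u f g b hN h hi
      rw [hS u f b hi]
      simpa using ih (u ++ [b]) f g hN (by simpa using hi.symm.trans h)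
    intro u f g hN h
    match f, g with
    | [], [] => rfl
    | [], b :: g =>
      refine key u [] g b (by simp at hN ⊢; omega) h (h.of_sublist_sublist (by simp) ?_)
      simp
    | a :: f, [] =>
      refine (key u [] f a (by simp at hN ⊢; omega) h.symm
        (h.symm.of_sublist_sublist (by simp) ?_)).symm
      simp
    | a :: f, b :: g =>
      by_cases hab : a = b
      · subst hab
        simpa using ih (u ++ [a]) f g (by simp at hN ⊢; omega) (by simpa using h)
      · rcases simK_insert_or_insert hab h with hi | hi
        · exact key u (a :: f) g b (by simp at hN ⊢; omega) h hi
        · exact (key u (b :: g) f a (by simp at hN ⊢; omega) h.symm hi).symm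

/-- `p ∼ₙ p b`, phrased through subwords. -/
def AbsorbsLetter (n : ℕ) (p : List A) (b : A) : Prop :=
  ∀ r : List A, r.Sublist p → r.length < n → (r ++ [b]).Sublist p

theorem AbsorbsLetter.of_simK {n : ℕ} {p q : List A} {b : A}
    (h : SimK (2 * n) (p ++ q) (p ++ b :: q)) :
    AbsorbsLetter n p b ∨ AbsorbsLetter n q.reverse b := by
  by_contra! hc
  simp only [AbsorbsLetter] at hc
  push Not at hc
  obtain ⟨⟨r, hr, hrn, hrb⟩, s, hs, hsn, hsb⟩ := hc
  have hs' : s.reverse.Sublist q := by simpa using hs.reverse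
  have := (h (r ++ b :: s.reverse) (by simp; omega)).2 (hr.append (hs'.cons_cons b))
  rcases append_cons_sublist_cases this with h1 | h1
  · exact hrb h1
  · exact hsb (by simpa using h1.reverse)

/-- `P` is a product of `n` blocks, each containing all the letters of the subsequent blocks
and of `z`. -/
def Nested (z : List A) : ℕ → List A → Prop
  | 0, P => P = []
  | n + 1, P => ∃ p₁ p₂, P = p₁ ++ p₂ ∧ (∀ c ∈ p₂ ++ z, c ∈ p₁) ∧ Nested z n p₂

theorem Nested.sublist {z : List A} : ∀ {n : ℕ} {P : List A}, Nested z n P →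
    ∀ {v w : List A}, (∀ c ∈ v, c ∈ z) → w.length ≤ n → w.Sublist (P ++ v) → w.Sublist P
  | 0, _, _, _, w, _, hw, _ => by
    have : w = [] := List.length_eq_zero_iff.1 (by omega)
    simp [this]
  | n + 1, _, ⟨p₁, p₂, rfl, hc, hn⟩, v, w, hv, hw, hs => by
    rw [List.append_assoc] at hs
    obtain ⟨w₁, w₂, rfl, h1, h2⟩ := List.sublist_append_iff.1 hs
    cases w₁ with
    | cons c w₁ => exact h1.append (hn.sublist hv (by simp at hw; omega) h2)
    | nil =>
      cases w₂ with
      | nil => simp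
      | cons c w₂ =>
        have hcm : c ∈ p₁ := by
          have : c ∈ p₂ ++ v := h2.subset (by simp)
          apply hc
          rw [List.mem_append] at this ⊢
          exact this.imp_right (hv c)
        have h3 := hn.sublist hv (by simpa using hw) ((List.sublist_cons_self c w₂).trans h2)
        simpa using (List.singleton_sublist.2 hcm).append h3

theorem Nested.simK {z P v : List A} {n : ℕ} (h : Nested z n P) (hv : ∀ c ∈ v, c ∈ z)
    (s q : List A) : SimK n (s ++ P ++ v ++ q) (s ++ P ++ q) := by
  intro w hw
  refine ⟨fun hs => ?_, fun hs => hs.trans (by simp)⟩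
  obtain ⟨w', w₃, rfl, hs, h3⟩ := List.sublist_append_iff.1 hs
  rw [List.append_assoc] at hs
  obtain ⟨w₁, w₂, rfl, h1, h2⟩ := List.sublist_append_iff.1 hs
  exact (h1.append (h.sublist hv (by simp at hw; omega) h2)).append h3

theorem Nested.split {z : List A} {m : ℕ} : ∀ {n : ℕ} {P : List A}, Nested z (n + m) P →
    ∃ P₁ P₂, P = P₁ ++ P₂ ∧ Nested (P₂ ++ z) n P₁ ∧ Nested z m P₂
  | 0, P, h => ⟨[], P, rfl, rfl, by simpa using h⟩
  | n + 1, P, h => by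
    rw [Nat.add_right_comm] at h
    obtain ⟨p₁, p₂, rfl, hc, hn⟩ := h
    obtain ⟨P₁, P₂, rfl, h1, h2⟩ := hn.split
    exact ⟨p₁ ++ P₁, P₂, by simp, ⟨p₁, P₁, rfl, by simpa using hc, h1⟩, h2⟩

/-- A nonempty word has a shortest prefix containing all its letters. -/
theorem exists_shortest_full_prefix (p : List A) (hp : p ≠ []) :
    ∃ p₁ c p₂, p = p₁ ++ c :: p₂ ∧ c ∉ p₁ ∧ ∀ d ∈ p₂, d ∈ p₁ ++ [c] := by
  induction p using List.reverseRecOn with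
  | nil => exact absurd rfl hp
  | append_singleton p a ih =>
    by_cases hp' : p = []
    · exact ⟨[], a, [], by simp [hp'], by simp, by simp⟩
    obtain ⟨p₁, c, p₂, rfl, hc, hd⟩ := ih hp'
    by_cases ha : a ∈ p₁ ++ [c]
    · refine ⟨p₁, c, p₂ ++ [a], by simp, hc, ?_⟩
      intro d hdm
      rcases List.mem_append.1 hdm with h | h
      · exact hd d h
      · rwa [List.mem_singleton.1 h]
    · refine ⟨p₁ ++ c :: p₂, a, [], by simp, ?_, by simp⟩
      intro h
      have := hd a
      simp at h ha this
      tauto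

theorem AbsorbsLetter.exists_nested {m : ℕ} {b : A} :
    ∀ {n : ℕ} {p : List A}, AbsorbsLetter (n + m) p b →
    ∃ P t, p = P ++ t ∧ Nested (b :: t) n P ∧ AbsorbsLetter m t b
  | 0, p, h => ⟨[], p, rfl, rfl, by simpa using h⟩
  | n + 1, p, h => by
    have hb : b ∈ p := List.singleton_sublist.1 (h [] (by simp) (by simp))
    obtain ⟨p₁, c, p₂, rfl, hc, hd⟩ := exists_shortest_full_prefix p (List.ne_nil_of_mem hb)
    have h2 : AbsorbsLetter (n + m) p₂ b := by
      intro r hr hrn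
      have h1 := h (c :: r) ((hr.cons_cons c).trans (List.sublist_append_right _ _))
        (by simp; omega)
      rcases append_cons_sublist_cases (r := []) h1 with h3 | h3
      · exact absurd (List.singleton_sublist.1 h3) hc
      · exact List.cons_sublist_cons.1 h3
    obtain ⟨P, t, rfl, hP, ht⟩ := h2.exists_nested
    refine ⟨p₁ ++ [c] ++ P, t, by simp, ⟨p₁ ++ [c], P, rfl, ?_, hP⟩, ht⟩
    intro d hdm
    have h1 := hd d
    simp only [List.mem_append, List.mem_cons, List.not_mem_nil, or_false] at hdm h1 hb ⊢
    rcases hdm with h | rfl | h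
    · exact h1 (Or.inl h)
    · have := hd d
      simp at this
      tauto
    · exact h1 (Or.inr h)

/-- A colouring with few `false` letters of a strongly absorbing word leaves a long nested
factor uncoloured. -/
theorem AbsorbsLetter.exists_uncolored {b : A} {M : ℕ} : ∀ {m : ℕ} {l : List (A × Bool)},
    (colorPart false l).length ≤ m → AbsorbsLetter ((m + 1) * M) (l.map Prod.fst) b →
    ∃ l₁ l₂ l₃, l = l₁ ++ l₂ ++ l₃ ∧ colorPart false l₂ = [] ∧
      Nested (b :: l₃.map Prod.fst) M (l₂.map Prod.fst)
  | m, l, hl, h => by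
    rw [show (m + 1) * M = M + m * M by ring] at h
    obtain ⟨P, t, hPt, hP, ht⟩ := h.exists_nested
    obtain ⟨l₂, l₃, rfl, rfl, rfl⟩ := List.map_eq_append_iff.1 hPt
    by_cases hf : colorPart false l₂ = []
    · exact ⟨[], l₂, l₃, by simp, hf, hP⟩
    have hpos := List.length_pos_iff.2 hf
    rw [colorPart_append, List.length_append] at hl
    match m with
    | 0 => omega
    | m + 1 =>
      obtain ⟨k₁, k₂, k₃, rfl, hk, hN⟩ :=
        AbsorbsLetter.exists_uncolored (m := m) (l := l₃) (by omega) ht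
      exact ⟨l₂ ++ k₁, k₂, k₃, by simp, hk, hN⟩

/-- After an absorbing prefix `p`, a factor in `b*` may be replaced by another one. -/
theorem AbsorbsLetter.exists_recoloring {k m : ℕ} {p q X Y : List A} {b : A}
    (h : AbsorbsLetter ((m + 1) * (k + m)) p b) (hX : ∀ c ∈ X, c = b) (hY : ∀ c ∈ Y, c = b)
    {l : List (A × Bool)} (hl : l.map Prod.fst = p ++ X ++ q)
    (hm : (colorPart false l).length ≤ m) :
    ∃ l' : List (A × Bool), l'.map Prod.fst = p ++ Y ++ q ∧
      colorPart false l' = colorPart false l ∧ SimK k (colorPart true l) (colorPart true l') := by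
  obtain ⟨l', lq, rfl, hl', rfl⟩ := List.map_eq_append_iff.1 hl
  obtain ⟨lp, lX, rfl, rfl, rfl⟩ := List.map_eq_append_iff.1 hl'
  simp only [colorPart_append, List.length_append] at hm
  obtain ⟨l₁, l₂, l₃, rfl, h2, hN⟩ := h.exists_uncolored (by omega)
  obtain ⟨P₁, P₂, hP, hN₁, hN₂⟩ := hN.split
  simp only [colorPart_append, List.length_append] at hm
  have hsub : ∀ c, ∀ d ∈ colorPart c l₃ ++ colorPart c lX, d ∈ b :: l₃.map Prod.fst := by
    intro c d hd
    rcases List.mem_append.1 hd with hd | hd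
    · exact List.mem_cons_of_mem _ ((colorPart_sublist _ _).subset hd)
    · rw [hX d ((colorPart_sublist _ _).subset hd)]
      exact List.mem_cons_self
  obtain ⟨lP, rfl, hlP⟩ := exists_coloring_of_sublist
    (hN₂.sublist (hsub false) (by simp; omega) (List.sublist_append_right _ _))
  refine ⟨l₁ ++ P₁.map (fun a => (a, true)) ++ lP ++
    (l₃.map Prod.fst ++ Y).map (fun a => (a, true)) ++ lq, ?_, ?_, ?_⟩
  · simp [hP, Function.comp_def]
  · simp only [colorPart_append, colorPart_map_const, h2, hlP]
    simp
  · simp only [colorPart_append, colorPart_map_const, colorPart_true_of_false_eq_nil _ h2, hP]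
    have e1 := hN₁.simK (v := lP.map Prod.fst ++ (colorPart true l₃ ++ colorPart true lX))
      (fun c hc => by
        rcases List.mem_append.1 hc with hc | hc
        · exact List.mem_append_left _ hc
        · exact List.mem_append_right _ (hsub true c hc)) (colorPart true l₁) (colorPart true lq)
    have e2 := hN₁.simK (v := colorPart true lP ++ (l₃.map Prod.fst ++ Y))
      (fun c hc => by
        rcases List.mem_append.1 hc with hc | hc
        · exact List.mem_append_left _ ((colorPart_sublist _ _).subset hc)
        · refine List.mem_append_right _ ?_
          rcases List.mem_append.1 hc with hc | hc
          · exact List.mem_cons_of_mem _ hc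
          · rw [hY c hc]
            exact List.mem_cons_self) (colorPart true l₁) (colorPart true lq)
    simpa using e1.trans e2.symm

theorem exists_recoloring_of_absorbs {k m : ℕ} {p q X Y : List A} {b : A}
    (h : AbsorbsLetter ((m + 1) * (k + m)) p b ∨ AbsorbsLetter ((m + 1) * (k + m)) q.reverse b)
    (hX : ∀ c ∈ X, c = b) (hY : ∀ c ∈ Y, c = b)
    {l : List (A × Bool)} (hl : l.map Prod.fst = p ++ X ++ q)
    (hm : (colorPart false l).length ≤ m) :
    ∃ l' : List (A × Bool), l'.map Prod.fst = p ++ Y ++ q ∧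
      colorPart false l' = colorPart false l ∧ SimK k (colorPart true l) (colorPart true l') := by
  rcases h with h | h
  · exact h.exists_recoloring hX hY hl hm
  · obtain ⟨l', h1, h2, h3⟩ := h.exists_recoloring (q := p.reverse) (X := X.reverse)
      (Y := Y.reverse) (l := l.reverse) (by simpa using hX) (by simpa using hY)
      (by simp [hl]) (by simpa [colorPart_reverse] using hm)
    refine ⟨l'.reverse, by simp [h1], ?_, SimK.of_reverse ?_⟩
    · rw [colorPart_reverse, h2, colorPart_reverse, List.reverse_reverse]
    · simpa [colorPart_reverse] using h3

theorem stmt14 {A : Type*} [Fintype A] (L : Set (List A)) (hL : PT L)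
    (F : Set (List A)) (hF : F.Finite) : PT (shuffleL L F) := by
  obtain ⟨k, hk⟩ := hL
  obtain ⟨m, hm⟩ := (hF.image List.length).bddAbove
  have hm' : ∀ w ∈ F, w.length ≤ m := fun w hw => hm ⟨w, hw, rfl⟩
  refine ⟨2 * ((m + 1) * (k + m)), fun x y hxy => mem_iff_of_simK ?_ hxy⟩
  intro p q b h
  have key : ∀ X Y : List A, (∀ c ∈ X, c = b) → (∀ c ∈ Y, c = b) →
      p ++ X ++ q ∈ shuffleL L F → p ++ Y ++ q ∈ shuffleL L F := by
    intro X Y hX hY hx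
    rw [mem_shuffleL_iff] at hx ⊢
    obtain ⟨l, hl, hlL, hlF⟩ := hx
    obtain ⟨l', h1, h2, h3⟩ :=
      exists_recoloring_of_absorbs (AbsorbsLetter.of_simK h) hX hY hl (hm' _ hlF)
    exact ⟨l', h1, (hk _ _ h3).1 hlL, h2 ▸ hlF⟩
  have h1 := key [] [b] (by simp) (by simp)
  have h2 := key [b] [] (by simp) (by simp)
  simp only [List.append_nil, List.append_assoc, List.singleton_append] at h1 h2
  exact ⟨h1, h2⟩
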